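/- arXiv:1806.06827 — 2 statements merged into one kernel-verified Lean document; each statement's English description precedes it below -/
import Mathlib

section
/- Let (x_1, y_1),...,(x_n, y_n) ∈ ℝ^d × {−1, +1} with all x_i ≠ 0, let P_n = (1/n) Σ_{i=1}^n δ_{(x_i, y_i)} be the associated empirical measure, and for w ∈ ℝ^d let c_w(x) = sign(⟨w, x⟩) be the corresponding linear classifier, with 0-1 empirical risk R(w, P_n) = (1/n) Σ_{i=1}^n 1[c_w(x_i) ≠ y_i]. Let Q = N(w₀, Σ) be the Gaussian measure on ℝ^d with mean w₀ and positive-definite covariance Σ. Then the average empirical risk satisfies R(Q, P_n) := ∫ R(w, P_n) dQ(w) = (1/n) Σ_{i=1}^n F̃( y_i ⟨w₀, x_i⟩ / ‖x_i‖_Σ ), where ‖x‖_Σ = sqrt(⟨Σx, x⟩), F is the standard normal cumulative distribution function, and F̃ = 1 − F. -/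
open MeasureTheory ProbabilityTheory Matrix

/-- The standard normal cumulative distribution function
`F(t) = ∫_{−∞}^t (1/√(2π)) e^{−u²/2} du`. -/
noncomputable def stdGaussCDF (t : ℝ) : ℝ :=
  ∫ u in Set.Iic t, (Real.sqrt (2 * Real.pi))⁻¹ * Real.exp (-u ^ 2 / 2)

/-- The standard Gaussian mass of `(-∞, t]` is `stdGaussCDF t`. -/
lemma gaussianReal_zero_one_real_Iic (t : ℝ) :
    (gaussianReal 0 1).real (Set.Iic t) = stdGaussCDF t := by
  rw [Measure.real, gaussianReal_apply_eq_integral 0 one_ne_zero, ENNReal.toReal_ofReal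
    (integral_nonneg fun u => gaussianPDFReal_nonneg 0 1 u)]
  simp [stdGaussCDF, gaussianPDFReal]

/-- The standard normal law is symmetric. -/
lemma stdGaussCDF_neg (t : ℝ) : stdGaussCDF (-t) = 1 - stdGaussCDF t := by
  have := nullSingletonClass_gaussianReal (μ := 0) (one_ne_zero (α := NNReal))
  rw [← gaussianReal_zero_one_real_Iic, ← gaussianReal_zero_one_real_Iic,
    ← probReal_compl_eq_one_sub measurableSet_Iic, Set.compl_Iic,
    measureReal_congr Ioi_ae_eq_Ici]
  conv_lhs => rw [← neg_zero, ← gaussianReal_map_neg,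
    map_measureReal_apply measurable_neg measurableSet_Iic]
  congr 1
  ext u
  simp

/-- The mass that `N(m, v)` gives to the nonpositive half-line. -/
lemma gaussianReal_real_Iic_zero (m : ℝ) {v : ℝ} (hv : 0 < v) :
    (gaussianReal m v.toNNReal).real (Set.Iic 0) = 1 - stdGaussCDF (m / √v) := by
  have hs : 0 < √v := Real.sqrt_pos.2 hv
  have hlaw : gaussianReal m v.toNNReal = (gaussianReal 0 1).map (fun u => m + √v * u) := by
    have h := gaussianReal_map_const_add (μ := √v * 0) (v := .mk (√v ^ 2) (sq_nonneg _) * 1) m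
    rw [← gaussianReal_map_const_mul, Measure.map_map (by fun_prop) (by fun_prop)] at h
    rw [show (fun u => m + √v * u) = (fun u => m + u) ∘ (fun u => √v * u) from rfl, h]
    congr 1
    · simp
    · ext
      simp [Real.sq_sqrt hv.le, hv.le]
  rw [hlaw, map_measureReal_apply (by fun_prop) measurableSet_Iic, ← stdGaussCDF_neg,
    ← gaussianReal_zero_one_real_Iic]
  congr 1
  ext u
  simp only [Set.mem_preimage, Set.mem_Iic, ← neg_div, le_div_iff₀ hs]
  constructor <;> intro h <;> linarith

/-- If `Z` has law `N(m, v)`, then the label `sign Z` differs from `y` with probability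
`1 - F(y m / √v)`. -/
lemma integral_sign_ne_label {Ω : Type*} [MeasurableSpace Ω] {Q : Measure Ω} {Z : Ω → ℝ}
    (hZ : Measurable Z) {m v : ℝ} (hv : 0 < v) (hlaw : Q.map Z = gaussianReal m v.toNNReal)
    {y : ℝ} (hy : y = 1 ∨ y = -1) :
    ∫ w, (if (if 0 < Z w then (1 : ℝ) else -1) = y then (0 : ℝ) else 1) ∂Q
      = 1 - stdGaussCDF (y * m / √v) := by
  have hIic : Q.real (Z ⁻¹' Set.Iic 0) = 1 - stdGaussCDF (m / √v) := by
    rw [← map_measureReal_apply hZ measurableSet_Iic, hlaw, gaussianReal_real_Iic_zero m hv]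
  have hIoi : Q.real (Z ⁻¹' Set.Ioi 0) = stdGaussCDF (m / √v) := by
    rw [← map_measureReal_apply hZ measurableSet_Ioi, hlaw, ← Set.compl_Iic,
      probReal_compl_eq_one_sub measurableSet_Iic, gaussianReal_real_Iic_zero m hv]
    ring
  rcases hy with rfl | rfl
  · rw [one_mul, ← hIic, ← integral_indicator_one (hZ measurableSet_Iic)]
    congr 1 with w
    by_cases h : 0 < Z w <;> simp [Set.indicator, h, not_lt.1]
    norm_num
  · rw [neg_one_mul, neg_div, stdGaussCDF_neg, sub_sub_cancel, ← hIoi,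
      ← integral_indicator_one (hZ measurableSet_Ioi)]
    congr 1 with w
    by_cases h : 0 < Z w <;> simp [Set.indicator, h]
    norm_num

/-- **Average empirical 0-1 risk of Gaussian random linear classifiers.**
Let `(x_1, y_1), ..., (x_n, y_n) ∈ ℝ^d × {−1,+1}` with all `x_i ≠ 0`, and for `w ∈ ℝ^d`
let `c_w(x) = sign⟨w, x⟩` with empirical 0-1 risk
`R(w, P_n) = (1/n) ∑ i 1[c_w(x_i) ≠ y_i]`.  If `Q = N(w₀, Σ)` is Gaussian with
positive-definite covariance `Σ` (characterized by: every linear functional `⟨u, W⟩`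
is Gaussian with mean `⟨u, w₀⟩` and variance `⟨Σu, u⟩`), then
`∫ R(w, P_n) dQ(w) = (1/n) ∑ i F̃( y_i ⟨w₀, x_i⟩ / ‖x_i‖_Σ )` where
`‖x‖_Σ = sqrt ⟨Σx, x⟩`, `F` is the standard normal CDF and `F̃ = 1 − F`. -/
theorem average_empirical_error_gaussian_linear
    (d n : ℕ) (hn : 0 < n)
    (x : Fin n → Fin d → ℝ) (hx : ∀ i, x i ≠ 0)
    (y : Fin n → ℝ) (hy : ∀ i, y i = 1 ∨ y i = -1)
    (w₀ : Fin d → ℝ) (Cov : Matrix (Fin d) (Fin d) ℝ) (hCov : Cov.PosDef)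
    (Q : Measure (Fin d → ℝ)) [IsProbabilityMeasure Q]
    (hgauss : ∀ u : Fin d → ℝ,
      Measure.map (fun w => u ⬝ᵥ w) Q
        = gaussianReal (u ⬝ᵥ w₀) (Real.toNNReal (Cov.mulVec u ⬝ᵥ u))) :
    ∫ w, (1 / (n : ℝ)) * ∑ i,
        (if (if 0 < w ⬝ᵥ x i then (1 : ℝ) else -1) = y i then (0 : ℝ) else 1) ∂Q
      = (1 / (n : ℝ)) * ∑ i,
        (1 - stdGaussCDF (y i * (w₀ ⬝ᵥ x i) / Real.sqrt (Cov.mulVec (x i) ⬝ᵥ x i))) := by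
  have hint : ∀ i, Integrable (fun w : Fin d → ℝ =>
      if (if 0 < w ⬝ᵥ x i then (1 : ℝ) else -1) = y i then (0 : ℝ) else 1) Q := by
    intro i
    have hmeas : Measurable fun w : Fin d → ℝ => w ⬝ᵥ x i := by
      simp only [dotProduct]
      fun_prop
    refine Integrable.of_bound (C := 1) (Measurable.aestronglyMeasurable ?_) ?_
    · exact Measurable.ite (measurableSet_eq_fun (Measurable.ite
        (measurableSet_lt measurable_const hmeas) measurable_const measurable_const)
        measurable_const) measurable_const measurable_const
    · filter_upwards with w
      split_ifs <;> simp
  rw [integral_const_mul, integral_finsetSum _ fun i _ => hint i]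
  congr 1
  refine Finset.sum_congr rfl fun i _ => ?_
  have hv : 0 < Cov.mulVec (x i) ⬝ᵥ x i := by
    have h := hCov.dotProduct_mulVec_pos (hx i)
    rwa [star_trivial, dotProduct_comm] at h
  have hmeas : Measurable fun w : Fin d → ℝ => x i ⬝ᵥ w := by
    simp only [dotProduct]
    fun_prop
  have h := integral_sign_ne_label hmeas hv (hgauss (x i)) (hy i)
  simpa only [dotProduct_comm (x i)] using h
end

section
/- Let H be a separable real Hilbert space, φ : X → H a feature map with ‖φ(x)‖ ≤ B for all x ∈ X, ℓ(t, y) = max(0, 1 − t·y) the hinge loss, and for λ > 0 let A(z_{1:n}) denote the unique minimizer over w ∈ H of (λ/2)‖w‖² + (1/n) Σ_{i=1}^n ℓ(⟨w, φ(x_i)⟩, y_i) for an n-tuple z_{1:n} = ((x_1,y_1),...,(x_n,y_n)) ∈ (X × {−1,+1})^n. Then the hypothesis sensitivity coefficient of A satisfies β_n ≤ 2B/(λn); that is, for any two n-tuples z_{1:n} and z'_{1:n} differing in at most one entry, ‖A(z_{1:n}) − A(z'_{1:n})‖ ≤ 2B/(λn). -/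
open scoped RealInnerProductSpace

/-- A minimizer of an `m`-strongly convex function satisfies the quadratic growth inequality. -/
theorem StrongConvexOn.norm_sub_sq_le_of_isMinOn {E : Type*} [NormedAddCommGroup E]
    [NormedSpace ℝ E] {s : Set E} {m : ℝ} {f : E → ℝ} (hf : StrongConvexOn s m f)
    {u : E} (hu : u ∈ s) (hmin : IsMinOn f s u) {w : E} (hw : w ∈ s) :
    m / 2 * ‖w - u‖ ^ 2 ≤ f w - f u := by
  have key : ∀ t : ℝ, 0 < t → t < 1 → (1 - t) * (m / 2 * ‖w - u‖ ^ 2) ≤ f w - f u := by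
    intro t ht ht1
    have h := hf.2 hw hu ht.le (sub_nonneg.2 ht1.le) (by ring)
    have h' : f u ≤ f (t • w + (1 - t) • u) :=
      hmin (hf.1 hw hu ht.le (sub_nonneg.2 ht1.le) (by ring))
    simp only [smul_eq_mul] at h
    refine le_of_mul_le_mul_left ?_ ht
    linarith
  have hlim : Filter.Tendsto (fun t : ℝ => (1 - t) * (m / 2 * ‖w - u‖ ^ 2))
      (nhdsWithin 0 (Set.Ioi 0)) (nhds (m / 2 * ‖w - u‖ ^ 2)) := by
    have hc : Continuous fun t : ℝ => (1 - t) * (m / 2 * ‖w - u‖ ^ 2) := by fun_prop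
    simpa using (hc.tendsto 0).mono_left nhdsWithin_le_nhds
  refine le_of_tendsto hlim ?_
  filter_upwards [Ioo_mem_nhdsGT (zero_lt_one' ℝ)] with t ht
  exact key t ht.1 ht.2

/-- The hinge loss of a linear predictor is convex in the weight vector. -/
theorem convexOn_hinge_inner {H : Type*} [NormedAddCommGroup H] [InnerProductSpace ℝ H]
    (x : H) (y : ℝ) : ConvexOn ℝ Set.univ fun w : H => max 0 (1 - ⟪w, x⟫ * y) := by
  refine (convexOn_const (0 : ℝ) convex_univ).sup ⟨convex_univ, fun v _ w _ a b _ _ hab => ?_⟩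
  simp only [inner_add_left, real_inner_smul_left, smul_eq_mul]
  linear_combination -hab

/-- The hinge loss of a linear predictor is `‖x‖`-Lipschitz in the weight vector. -/
theorem hinge_inner_sub_le {H : Type*} [NormedAddCommGroup H] [InnerProductSpace ℝ H]
    (x v w : H) {y : ℝ} (hy : |y| ≤ 1) :
    max 0 (1 - ⟪v, x⟫ * y) - max 0 (1 - ⟪w, x⟫ * y) ≤ ‖x‖ * ‖v - w‖ := by
  have hle : -(⟪v - w, x⟫ * y) ≤ ‖x‖ * ‖v - w‖ :=
    calc -(⟪v - w, x⟫ * y) ≤ |⟪v - w, x⟫| * |y| := (neg_le_abs _).trans (abs_mul _ _).le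
      _ ≤ |⟪v - w, x⟫| := mul_le_of_le_one_right (abs_nonneg _) hy
      _ ≤ ‖x‖ * ‖v - w‖ := (abs_real_inner_le_norm _ _).trans (mul_comm _ _).le
  rw [inner_sub_left] at hle
  have h0 : 0 ≤ ‖x‖ * ‖v - w‖ := by positivity
  rw [sub_le_iff_le_add]
  refine max_le (add_nonneg h0 (le_max_left _ _)) ?_
  have := le_max_right 0 (1 - ⟪w, x⟫ * y)
  linarith

/-- The regularized empirical hinge loss is `c`-strongly convex. -/
theorem strongConvexOn_regularized_hinge {ι H : Type*} [Fintype ι] [NormedAddCommGroup H]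
    [InnerProductSpace ℝ H] (c : ℝ) {r : ℝ} (hr : 0 ≤ r) (x : ι → H) (y : ι → ℝ) :
    StrongConvexOn Set.univ c fun w : H =>
      c / 2 * ‖w‖ ^ 2 + r * ∑ i, max 0 (1 - ⟪w, x i⟫ * y i) := by
  rw [strongConvexOn_iff_convex]
  simp only [add_sub_cancel_left]
  have hsum : ConvexOn ℝ Set.univ fun w : H => ∑ i, max 0 (1 - ⟪w, x i⟫ * y i) := by
    refine ⟨convex_univ, fun v hv w hw a b ha hb hab => ?_⟩
    simp only [smul_eq_mul, Finset.mul_sum, ← Finset.sum_add_distrib]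
    exact Finset.sum_le_sum fun i _ => (convexOn_hinge_inner (x i) (y i)).2 hv hw ha hb hab
  exact hsum.smul hr

/-- **Hypothesis stability of the SVM.**
Let `H` be a separable real Hilbert space, `φ : X → H` a feature map with `‖φ x‖ ≤ B`,
and for `λ > 0` let `A` map each `n`-tuple `T = ((x_1,y_1),...,(x_n,y_n))` with labels in
`{−1,+1}` to the minimizer over `w ∈ H` of the SVM objective
`(λ/2)‖w‖² + (1/n) ∑ i, max 0 (1 − ⟪w, φ x_i⟫ y_i)` (hinge loss).
Then the hypothesis sensitivity coefficient of `A` satisfies `β_n ≤ 2B/(λ n)`: for any two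
`n`-tuples differing in at most one entry, `‖A T − A T'‖ ≤ 2B/(λ n)`. -/
theorem svm_hypothesis_sensitivity
    {X H : Type*}
    [NormedAddCommGroup H] [InnerProductSpace ℝ H] [CompleteSpace H]
    [SecondCountableTopology H]
    (φ : X → H) (B : ℝ) (hφ : ∀ x, ‖φ x‖ ≤ B)
    (lam : ℝ) (hlam : 0 < lam)
    (n : ℕ) (hn : 0 < n)
    (A : (Fin n → X × ({-1, 1} : Set ℝ)) → H)
    (hmin : ∀ (T : Fin n → X × ({-1, 1} : Set ℝ)) (w : H),
      lam / 2 * ‖A T‖ ^ 2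
          + (1 / (n : ℝ)) * ∑ i, max 0 (1 - ⟪A T, φ (T i).1⟫ * ((T i).2 : ℝ))
        ≤ lam / 2 * ‖w‖ ^ 2
          + (1 / (n : ℝ)) * ∑ i, max 0 (1 - ⟪w, φ (T i).1⟫ * ((T i).2 : ℝ)))
    (T T' : Fin n → X × ({-1, 1} : Set ℝ))
    (hTT' : ∃ i, ∀ j, j ≠ i → T j = T' j) :
    ‖A T - A T'‖ ≤ 2 * B / (lam * n) := by
  obtain ⟨i, hi⟩ := hTT'
  have hn' : (0 : ℝ) < n := Nat.cast_pos.2 hn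
  have hr : (0 : ℝ) ≤ 1 / (n : ℝ) := by positivity
  have growth : ∀ (S : Fin n → X × ({-1, 1} : Set ℝ)) (w : H), _ := fun S w =>
    (strongConvexOn_regularized_hinge lam hr (fun j => φ (S j).1)
      fun j => ((S j).2 : ℝ)).norm_sub_sq_le_of_isMinOn
        (Set.mem_univ (A S)) (fun w _ => hmin S w) (Set.mem_univ w)
  have h₁ := growth T (A T')
  have h₂ := growth T' (A T)
  have hlabel : ∀ y : ({-1, 1} : Set ℝ), |(y : ℝ)| ≤ 1 := by
    rintro ⟨y, rfl | rfl⟩ <;> simp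
  have hloss : ∀ (z : X × ({-1, 1} : Set ℝ)) (v w : H),
      max 0 (1 - ⟪v, φ z.1⟫ * (z.2 : ℝ)) - max 0 (1 - ⟪w, φ z.1⟫ * (z.2 : ℝ))
        ≤ B * ‖v - w‖ := fun z v w =>
    (hinge_inner_sub_le (φ z.1) v w (hlabel z.2)).trans
      (mul_le_mul_of_nonneg_right (hφ z.1) (norm_nonneg _))
  have hrest : ∀ w : H,
      ∑ j ∈ Finset.univ.erase i, max 0 (1 - ⟪w, φ (T j).1⟫ * ((T j).2 : ℝ))
        = ∑ j ∈ Finset.univ.erase i, max 0 (1 - ⟪w, φ (T' j).1⟫ * ((T' j).2 : ℝ)) := fun w =>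
    Finset.sum_congr rfl fun j hj => by rw [hi j (Finset.ne_of_mem_erase hj)]
  simp only [← Finset.add_sum_erase _ _ (Finset.mem_univ i), hrest] at h₁ h₂
  have l₁ := mul_le_mul_of_nonneg_left (hloss (T i) (A T') (A T)) hr
  have l₂ := mul_le_mul_of_nonneg_left (hloss (T' i) (A T) (A T')) hr
  rw [norm_sub_rev (A T') (A T)] at h₁ l₁
  have hsq : lam * ‖A T - A T'‖ ^ 2 ≤ 1 / n * (2 * B * ‖A T - A T'‖) := by linarith
  have hB : 0 ≤ B := (norm_nonneg _).trans (hφ (T i).1)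
  rcases (norm_nonneg (A T - A T')).eq_or_lt with h0 | hpos
  · rw [← h0]
    positivity
  · rw [le_div_iff₀ (by positivity)]
    refine le_of_mul_le_mul_right ?_ hpos
    rw [one_div, inv_mul_eq_div, le_div_iff₀ hn'] at hsq
    linarith
end
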